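/- arXiv:1211.5217 — 2 statements merged into one kernel-verified Lean document; each statement's English description precedes it below -/
import Mathlib

section
/- Let a, b > 0 with a − 2b > 0, η ∈ (0, √(a−b) − √(a/2)), and φ_η an admissible cutoff. Let (f̃, g̃) ∈ 𝒜 and let (f, g) be the solution of the autonomous system f' = g(f² − a g² + b), g' = f(1 − g²) with initial data (f̃, g̃). Let (f̃ⁿ, g̃ⁿ) ∈ 𝒜 and ρₙ > 0 be sequences with ρₙ → +∞ and (f̃ⁿ, g̃ⁿ) → (f̃, g̃), and let (fⁿ, gⁿ) be a solution of (fⁿ)' + (2φ_η(fⁿ,gⁿ)/(ρₙ + r)) fⁿ = gⁿ((fⁿ)² − a (gⁿ)² + b), (gⁿ)' = fⁿ(1 − (gⁿ)²) with fⁿ(0) = f̃ⁿ, gⁿ(0) = g̃ⁿ. Then each (fⁿ, gⁿ) is defined on [0, +∞), and (fⁿ, gⁿ) converges to (f, g) uniformly on every bounded interval. -/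
open Real Set Filter Topology

noncomputable section

/-- The Hamiltonian energy `H(f,g) = ½ f²(1−g²) + (a/4) g⁴ − (b/2) g²`. -/
def Ham (a b f g : ℝ) : ℝ := 1 / 2 * f ^ 2 * (1 - g ^ 2) + a / 4 * g ^ 4 - b / 2 * g ^ 2

/-- The set `𝒜` of admissible points. -/
def Aadm (a b : ℝ) : Set (ℝ × ℝ) :=
  {p | 2 * p.1 ^ 2 - a * p.2 ^ 2 - (a - 2 * b) ≤ 0 ∧ p.2 ^ 2 ≤ 1}

/-- `φ` is an admissible cutoff function `φ_η`. -/
def IsCutoff (a b η : ℝ) (φ : ℝ → ℝ → ℝ) : Prop :=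
  (∀ f g, φ f g ∈ Icc (0 : ℝ) 1) ∧
  ContDiffOn ℝ (⊤ : ℕ∞) (fun p : ℝ × ℝ => φ p.1 p.2)
    (Ioo (-Real.sqrt (a - b)) (Real.sqrt (a - b)) ×ˢ (univ : Set ℝ)) ∧
  (∀ f g, φ f g = φ |f| |g|) ∧
  (∀ f g, Real.sqrt (a - b) - η / 2 ≤ |f| → φ f g = 0) ∧
  (∀ f g, |f| ≤ Real.sqrt (a - b) - η → φ f g = 1)

/-- `(f, g)` is a `C¹` solution on `s` of the original Cauchy problem
`f' + (2/r) f = g(f² − a g² + b)`, `g' = f(1 − g²)`, `f(0) = 0`, `g(0) = x`. -/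
def IsSolOn (a b x : ℝ) (f g : ℝ → ℝ) (s : Set ℝ) : Prop :=
  f 0 = 0 ∧ g 0 = x ∧ ContinuousOn f s ∧ ContinuousOn g s ∧
  ∀ r ∈ s, 0 < r →
    HasDerivAt f (g r * ((f r) ^ 2 - a * (g r) ^ 2 + b) - 2 / r * f r) r ∧
    HasDerivAt g (f r * (1 - (g r) ^ 2)) r

/-- `(f, g)` is a `C¹` solution on `s` of the regularized Cauchy problem
`f' + (2 φ(f,g)/r) f = g(f² − a g² + b)`, `g' = f(1 − g²)`, `f(0) = 0`, `g(0) = x`. -/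
def IsRegSolOn (a b : ℝ) (φ : ℝ → ℝ → ℝ) (x : ℝ) (f g : ℝ → ℝ) (s : Set ℝ) : Prop :=
  f 0 = 0 ∧ g 0 = x ∧ ContinuousOn f s ∧ ContinuousOn g s ∧
  ∀ r ∈ s, 0 < r →
    HasDerivAt f (g r * ((f r) ^ 2 - a * (g r) ^ 2 + b) - 2 * φ (f r) (g r) / r * f r) r ∧
    HasDerivAt g (f r * (1 - (g r) ^ 2)) r

/-- `(f, g)` is a solution on `s` of the autonomous (Hamiltonian) system
`f' = g(f² − a g² + b)`, `g' = f(1 − g²)` with initial data `(fi, gi)`. -/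
def IsAutSolOn (a b fi gi : ℝ) (f g : ℝ → ℝ) (s : Set ℝ) : Prop :=
  f 0 = fi ∧ g 0 = gi ∧ ContinuousOn f s ∧ ContinuousOn g s ∧
  ∀ r ∈ s,
    HasDerivAt f (g r * ((f r) ^ 2 - a * (g r) ^ 2 + b)) r ∧
    HasDerivAt g (f r * (1 - (g r) ^ 2)) r

/-- `(f, g)` is a solution on `s` of the shifted regularized system
`f' + (2 φ(f,g)/(ρ+r)) f = g(f² − a g² + b)`, `g' = f(1 − g²)` with initial data `(fi, gi)`. -/
def IsShiftSolOn (a b : ℝ) (φ : ℝ → ℝ → ℝ) (ρ fi gi : ℝ) (f g : ℝ → ℝ) (s : Set ℝ) : Prop :=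
  f 0 = fi ∧ g 0 = gi ∧ ContinuousOn f s ∧ ContinuousOn g s ∧
  ∀ r ∈ s,
    HasDerivAt f (g r * ((f r) ^ 2 - a * (g r) ^ 2 + b) - 2 * φ (f r) (g r) / (ρ + r) * f r) r ∧
    HasDerivAt g (f r * (1 - (g r) ^ 2)) r

/-- The interval `[0, R)` with possibly infinite right endpoint. -/
def edom (R : EReal) : Set ℝ := {r : ℝ | 0 ≤ r ∧ (r : EReal) < R}

/-- `g` changes sign at `r₀` relative to the interval `s`. -/
def ChangesSignAt (g : ℝ → ℝ) (s : Set ℝ) (r₀ : ℝ) : Prop :=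
  g r₀ = 0 ∧ ∃ ε > 0, Icc (r₀ - ε) (r₀ + ε) ⊆ s ∧
    g (r₀ - ε) * g (r₀ + ε) < 0 ∧ ∀ r ∈ Ioo (0 : ℝ) ε, g (r₀ - r) * g (r₀ + r) ≤ 0

/-- `g` changes sign exactly `k` times on `s`. -/
def ChangesSignExactly (g : ℝ → ℝ) (s : Set ℝ) (k : ℕ) : Prop :=
  {r | ChangesSignAt g s r}.Finite ∧ {r | ChangesSignAt g s r}.ncard = k

/-- The set `A_k`, for the family of solutions `x ↦ (F x, G x)`. -/
def Aset (a b : ℝ) (F G : ℝ → ℝ → ℝ) (k : ℕ) : Set ℝ :=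
  {x | x ∈ Ioo (0 : ℝ) 1 ∧
    (∃ L, L < 0 ∧ Tendsto (fun r => Ham a b (F x r) (G x r)) atTop (nhds L)) ∧
    ChangesSignExactly (G x) (Ioi 0) k}

/-- The set `I_k`, for the family of solutions `x ↦ (F x, G x)`. -/
def Iset (a b : ℝ) (F G : ℝ → ℝ → ℝ) (k : ℕ) : Set ℝ :=
  {x | x ∈ Ioo (0 : ℝ) 1 ∧
    Tendsto (fun r => (F x r, G x r)) atTop (nhds ((0 : ℝ), (0 : ℝ))) ∧
    ChangesSignExactly (G x) (Ioi 0) k}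

open scoped NNReal

/-- A function with `u' ≤ c u`, `|c| ≤ M`, that is nonpositive initially stays nonpositive. -/
lemma nonpos_of_deriv_le_mul {T M : ℝ} {u u' c : ℝ → ℝ}
    (hu : ContinuousOn u (Icc 0 T)) (hu' : ∀ r ∈ Ico 0 T, HasDerivAt u (u' r) r)
    (hc : ∀ r ∈ Ico 0 T, |c r| ≤ M) (hle : ∀ r ∈ Ico 0 T, u' r ≤ c r * u r) (h0 : u 0 ≤ 0) :
    ∀ r ∈ Icc 0 T, u r ≤ 0 := by
  have key : ∀ ε > 0, ∀ r ∈ Icc 0 T, u r ≤ ε * exp ((M + 1) * r) := by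
    intro ε hε
    have hB : ∀ x, HasDerivAt (fun r => ε * exp ((M + 1) * r))
        (ε * (exp ((M + 1) * x) * ((M + 1) * 1))) x := fun x =>
      (((hasDerivAt_id x).const_mul (M + 1)).exp).const_mul ε
    refine image_le_of_deriv_right_lt_deriv_boundary hu
      (fun r hr => (hu' r hr).hasDerivWithinAt) ?_ hB ?_
    · simpa using h0.trans hε.le
    · intro r hr heq
      have hpos : 0 < ε * exp ((M + 1) * r) := by positivity
      have h1 : c r * u r ≤ M * u r :=
        mul_le_mul_of_nonneg_right ((le_abs_self _).trans (hc r hr)) (heq ▸ hpos.le)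
      have h2 := hle r hr
      rw [heq] at h1 h2
      nlinarith
  intro r hr
  have hlim : Tendsto (fun ε : ℝ => ε * exp ((M + 1) * r)) (𝓝[>] 0) (𝓝 0) := by
    have : Tendsto (fun ε : ℝ => ε * exp ((M + 1) * r)) (𝓝 0) (𝓝 (0 * exp ((M + 1) * r))) :=
      tendsto_id.mul_const _
    rw [zero_mul] at this
    exact this.mono_left nhdsWithin_le_nhds
  exact ge_of_tendsto hlim (eventually_mem_nhdsWithin.mono fun ε hε => key ε hε r hr)

/-- The set `𝒜` is forward invariant under time-rescaled damped Hamiltonian dynamics. -/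
lemma mem_Aadm_of_hasDerivAt {a b T : ℝ} {f g c d : ℝ → ℝ}
    (hc : ∀ r ∈ Ico 0 T, c r ∈ Icc (0 : ℝ) 1) (hd : ∀ r ∈ Ico 0 T, 0 ≤ d r)
    (hf : ContinuousOn f (Icc 0 T)) (hg : ContinuousOn g (Icc 0 T))
    (hf' : ∀ r ∈ Ico 0 T,
      HasDerivAt f (c r * (g r * (f r ^ 2 - a * g r ^ 2 + b) - d r * f r)) r)
    (hg' : ∀ r ∈ Ico 0 T, HasDerivAt g (c r * (f r * (1 - g r ^ 2))) r)
    (h0 : (f 0, g 0) ∈ Aadm a b) :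
    ∀ r ∈ Icc 0 T, (f r, g r) ∈ Aadm a b := by
  obtain ⟨M, hM⟩ := isCompact_Icc.exists_bound_of_continuousOn (hf.mul hg)
  have hbound : ∀ r ∈ Ico 0 T, |2 * c r * (f r * g r)| ≤ 2 * M := by
    intro r hr
    have h1 : ‖f r * g r‖ ≤ M := hM r (Ico_subset_Icc_self hr)
    have h2 := hc r hr
    rw [Real.norm_eq_abs] at h1
    rw [abs_mul, abs_of_nonneg (by linarith [h2.1])]
    nlinarith [abs_nonneg (f r * g r), h2.1, h2.2]
  have hbound' : ∀ r ∈ Ico 0 T, |-(2 * c r * (f r * g r))| ≤ 2 * M := by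
    simpa only [abs_neg] using hbound
  have hK := nonpos_of_deriv_le_mul (u := fun r => 2 * f r ^ 2 - a * g r ^ 2 - (a - 2 * b))
    (by fun_prop)
    (fun r hr => ((((hf' r hr).pow 2).const_mul 2).sub
      (((hg' r hr).pow 2).const_mul a)).sub_const (a - 2 * b)) hbound
    (fun r hr => by
      have : 0 ≤ c r * d r * f r ^ 2 :=
        mul_nonneg (mul_nonneg (hc r hr).1 (hd r hr)) (sq_nonneg _)
      norm_num
      nlinarith) h0.1
  have hG := nonpos_of_deriv_le_mul (u := fun r => g r ^ 2 - 1)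
    (by fun_prop) (fun r hr => ((hg' r hr).pow 2).sub_const 1) hbound'
    (fun r hr => by norm_num; nlinarith) (sub_nonpos.2 h0.2)
  exact fun r hr => ⟨hK r hr, sub_nonpos.1 (hG r hr)⟩

lemma norm_le_of_mem_Aadm {a b : ℝ} (ha : 0 < a) (hb : 0 < b) {p : ℝ × ℝ}
    (hp : p ∈ Aadm a b) : ‖p‖ ≤ a + 1 := by
  obtain ⟨h1, h2⟩ := hp
  rw [Prod.norm_def, Real.norm_eq_abs, Real.norm_eq_abs]
  refine max_le (abs_le_of_sq_le_sq ?_ (by linarith)) (abs_le_of_sq_le_sq ?_ (by linarith)) <;>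
    nlinarith

/-- The Hamiltonian vector field. -/
def hamField (a b : ℝ) (p : ℝ × ℝ) : ℝ × ℝ :=
  (p.2 * (p.1 ^ 2 - a * p.2 ^ 2 + b), p.1 * (1 - p.2 ^ 2))

/-- The damping direction of the regularized system. -/
def dampField (φ : ℝ → ℝ → ℝ) (p : ℝ × ℝ) : ℝ × ℝ := (φ p.1 p.2 * p.1, 0)

lemma contDiff_hamField (a b : ℝ) : ContDiff ℝ 1 (hamField a b) := by
  unfold hamField
  fun_prop

/-- Since a cutoff vanishes near the boundary of the strip where it is smooth, it is smooth
everywhere. -/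
lemma IsCutoff.contDiff {a b η : ℝ} {φ : ℝ → ℝ → ℝ} (hφ : IsCutoff a b η φ) (hη : 0 < η) :
    ContDiff ℝ 1 (fun p : ℝ × ℝ => φ p.1 p.2) := by
  obtain ⟨-, hsmooth, -, hzero, -⟩ := hφ
  rw [contDiff_iff_contDiffAt]
  intro p
  by_cases hp : |p.1| < √(a - b)
  · refine (hsmooth.contDiffAt ((isOpen_Ioo.prod isOpen_univ).mem_nhds ?_)).of_le
      (by exact_mod_cast le_top)
    exact ⟨abs_lt.1 hp, mem_univ _⟩
  · have hev : ∀ᶠ q : ℝ × ℝ in 𝓝 p, √(a - b) - η / 2 < |q.1| :=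
      continuous_fst.abs.continuousAt.eventually (lt_mem_nhds (by linarith [not_lt.1 hp]))
    exact (contDiffAt_const (c := (0 : ℝ))).congr_of_eventuallyEq
      (hev.mono fun q hq => hzero q.1 q.2 hq.le)

lemma IsCutoff.contDiff_dampField {a b η : ℝ} {φ : ℝ → ℝ → ℝ} (hφ : IsCutoff a b η φ)
    (hη : 0 < η) : ContDiff ℝ 1 (dampField φ) :=
  ((hφ.contDiff hη).mul contDiff_fst).prodMk contDiff_const

lemma exists_lipschitzWith_norm_le_smul {χ : ℝ × ℝ → ℝ} (hχ : ContDiff ℝ 1 χ)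
    (hsupp : HasCompactSupport χ) {V : ℝ × ℝ → ℝ × ℝ} (hV : ContDiff ℝ 1 V) :
    ∃ K C : ℝ≥0, LipschitzWith K (fun p => χ p • V p) ∧ ∀ p, ‖χ p • V p‖ ≤ C := by
  have hsm : ContDiff ℝ 1 (fun p => χ p • V p) := hχ.smul hV
  have hcs : HasCompactSupport (fun p => χ p • V p) := hsupp.smul_right
  obtain ⟨K, hK⟩ := hsm.lipschitzWith_of_hasCompactSupport hcs one_ne_zero
  obtain ⟨C, hC⟩ := hcs.exists_bound_of_continuous hsm.continuous
  exact ⟨K, C.toNNReal, hK, fun p => (hC p).trans (le_coe_toNNReal C)⟩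

lemma lipschitzOnWith_sub_smul {E : Type*} [NormedAddCommGroup E] [NormedSpace ℝ E] {V W : E → E}
    {s : Set E} {K₁ K₂ D : ℝ≥0} (hV : LipschitzOnWith K₁ V s) (hW : LipschitzOnWith K₂ W s) {d : ℝ}
    (hd : |d| ≤ D) : LipschitzOnWith (K₁ + D * K₂) (fun p => V p - d • W p) s := by
  refine LipschitzOnWith.of_dist_le_mul fun x hx y hy => ?_
  have h1 := hV.dist_le_mul x hx y hy
  have h2 := hW.dist_le_mul x hx y hy
  rw [dist_eq_norm] at h1 h2 ⊢
  calc ‖V x - d • W x - (V y - d • W y)‖ = ‖(V x - V y) - d • (W x - W y)‖ := by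
        congr 1; module
    _ ≤ ‖V x - V y‖ + |d| * ‖W x - W y‖ := by
        simpa only [norm_smul, Real.norm_eq_abs] using norm_sub_le (V x - V y) (d • (W x - W y))
    _ ≤ K₁ * dist x y + D * (K₂ * dist x y) := by gcongr
    _ = _ := by push_cast; ring

/-- Solutions of `α' = V α - d(t) W α` with `V`, `W` bounded and Lipschitz exist on every
interval where `d` is continuous and bounded. -/
lemma exists_hasDerivAt_sub_smul {E : Type*} [NormedAddCommGroup E] [NormedSpace ℝ E]
    [CompleteSpace E] {V W : E → E} {K₁ K₂ C₁ C₂ D : ℝ≥0}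
    (hV : LipschitzWith K₁ V) (hW : LipschitzWith K₂ W)
    (hVC : ∀ p, ‖V p‖ ≤ C₁) (hWC : ∀ p, ‖W p‖ ≤ C₂) {d : ℝ → ℝ} {s T : ℝ} (hs : 0 < s) (hT : 0 < T)
    (hdc : ContinuousOn d (Icc (-s) T)) (hdD : ∀ t ∈ Icc (-s) T, |d t| ≤ D) (x₀ : E) :
    ∃ α : ℝ → E, α 0 = x₀ ∧ ∀ t ∈ Ioo (-s) T, HasDerivAt α (V (α t) - d t • W (α t)) t := by
  have hpl : IsPicardLindelof (fun t p => V p - d t • W p) (tmin := -s) (tmax := T)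
      ⟨0, by linarith, hT.le⟩ x₀ ((C₁ + D * C₂) * (max T s).toNNReal) 0 (C₁ + D * C₂)
      (K₁ + D * K₂) :=
    { lipschitzOnWith := fun t ht =>
        lipschitzOnWith_sub_smul hV.lipschitzOnWith hW.lipschitzOnWith (hdD t ht)
      continuousOn := fun x _ => by fun_prop
      norm_le := fun t ht x _ => by
        refine (norm_sub_le _ _).trans ?_
        rw [norm_smul, Real.norm_eq_abs]
        push_cast
        gcongr
        exacts [hVC x, hdD t ht, hWC x]
      mul_max_le := by
        have : 0 ≤ max T s := hT.le.trans (le_max_left _ _)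
        simp [this] }
  obtain ⟨α, h0, h⟩ := hpl.exists_eq_forall_mem_Icc_hasDerivWithinAt₀
  exact ⟨α, h0, fun t ht =>
    (h t (Ioo_subset_Icc_self ht)).hasDerivAt (Icc_mem_nhds ht.1 ht.2)⟩

lemma Icc_subset_edom {R : EReal} {r : ℝ} (hr : r ∈ edom R) : Icc 0 r ⊆ edom R :=
  fun _ ht => ⟨ht.1, (EReal.coe_le_coe_iff.2 ht.2).trans_lt hr.2⟩

lemma edom_top : edom ⊤ = Ici 0 := by
  ext r
  simp [edom, EReal.coe_lt_top]

lemma IsShiftSolOn.mono {a b ρ fi gi : ℝ} {φ : ℝ → ℝ → ℝ} {f g : ℝ → ℝ} {s t : Set ℝ}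
    (h : IsShiftSolOn a b φ ρ fi gi f g t) (hst : s ⊆ t) :
    IsShiftSolOn a b φ ρ fi gi f g s :=
  ⟨h.1, h.2.1, h.2.2.1.mono hst, h.2.2.2.1.mono hst, fun r hr => h.2.2.2.2 r (hst hr)⟩

lemma IsShiftSolOn.hasDerivAt_prodMk {a b ρ fi gi : ℝ} {φ : ℝ → ℝ → ℝ} {f g : ℝ → ℝ} {s : Set ℝ}
    (h : IsShiftSolOn a b φ ρ fi gi f g s) {r : ℝ} (hr : r ∈ s) :
    HasDerivAt (fun r => (f r, g r))
      (hamField a b (f r, g r) - (2 / (ρ + r)) • dampField φ (f r, g r)) r := by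
  convert! (h.2.2.2.2 r hr).1.prodMk (h.2.2.2.2 r hr).2 using 1
  ext
  · simp [hamField, dampField]
    ring
  · simp [hamField, dampField]

lemma IsShiftSolOn.mem_Aadm {a b ρ fi gi T : ℝ} {φ : ℝ → ℝ → ℝ} {f g : ℝ → ℝ}
    (hφ : ∀ f g, 0 ≤ φ f g) (hρ : 0 < ρ) (hi : (fi, gi) ∈ Aadm a b)
    (h : IsShiftSolOn a b φ ρ fi gi f g (Icc 0 T)) :
    ∀ r ∈ Icc 0 T, (f r, g r) ∈ Aadm a b := by
  obtain ⟨h0, h0', hf, hg, hd⟩ := h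
  refine mem_Aadm_of_hasDerivAt (c := fun _ => 1) (d := fun r => 2 * φ (f r) (g r) / (ρ + r))
    (fun _ _ => ⟨zero_le_one, le_rfl⟩)
    (fun r hr => div_nonneg (mul_nonneg zero_le_two (hφ _ _)) (by linarith [hr.1])) hf hg
    (fun r hr => ?_) (fun r hr => ?_) (by rwa [h0, h0'])
  · simpa only [one_mul] using (hd r (Ico_subset_Icc_self hr)).1
  · simpa only [one_mul] using (hd r (Ico_subset_Icc_self hr)).2

lemma IsAutSolOn.isShiftSolOn {a b fi gi ρ : ℝ} {f g : ℝ → ℝ} {s : Set ℝ}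
    (h : IsAutSolOn a b fi gi f g s) : IsShiftSolOn a b (fun _ _ => 0) ρ fi gi f g s := by
  simpa [IsShiftSolOn, IsAutSolOn] using h

/-- The shifted regularized system has solutions on arbitrarily long intervals. -/
lemma exists_isShiftSolOn {a b η ρ fi gi : ℝ} {φ : ℝ → ℝ → ℝ} (ha : 0 < a) (hb : 0 < b)
    (hη : 0 < η) (hφ : IsCutoff a b η φ) (hρ : 0 < ρ) (hi : (fi, gi) ∈ Aadm a b) {T : ℝ}
    (hT : 0 < T) : ∃ F G : ℝ → ℝ, IsShiftSolOn a b φ ρ fi gi F G (Icc 0 T) := by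
  let χ : ContDiffBump (0 : ℝ × ℝ) := ⟨a + 1, a + 2, by linarith, by linarith⟩
  obtain ⟨K₁, C₁, hK₁, hC₁⟩ := exists_lipschitzWith_norm_le_smul χ.contDiff χ.hasCompactSupport
    (contDiff_hamField a b)
  obtain ⟨K₂, C₂, hK₂, hC₂⟩ := exists_lipschitzWith_norm_le_smul χ.contDiff χ.hasCompactSupport
    (hφ.contDiff_dampField hη)
  have hne : ∀ t ∈ Icc (-(ρ / 2)) (T + 1), ρ / 2 ≤ ρ + t := fun t ht => by linarith [ht.1]
  obtain ⟨α, hα0, hα⟩ := exists_hasDerivAt_sub_smul (D := (4 / ρ).toNNReal)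
    (d := fun t => 2 / (ρ + t)) (s := ρ / 2) (T := T + 1) hK₁ hK₂ hC₁ hC₂ (by linarith)
    (by linarith)
    (continuousOn_const.div (by fun_prop) fun t ht => by linarith [hne t ht])
    (fun t ht => by
      have h1 := hne t ht
      rw [abs_of_nonneg (div_nonneg zero_le_two (by linarith)), coe_toNNReal _ (by positivity)]
      calc 2 / (ρ + t) ≤ 2 / (ρ / 2) := by gcongr
        _ = 4 / ρ := by field_simp; norm_num) (fi, gi)
  have hsub : Icc 0 T ⊆ Ioo (-(ρ / 2)) (T + 1) := fun t ht =>
    ⟨by linarith [ht.1], by linarith [ht.2]⟩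
  have h1 : ∀ t ∈ Icc 0 T, HasDerivAt (fun t => (α t).1) (χ (α t) * ((α t).2 *
      ((α t).1 ^ 2 - a * (α t).2 ^ 2 + b) - 2 * φ (α t).1 (α t).2 / (ρ + t) * (α t).1)) t := by
    intro t ht
    convert! hasFDerivAt_fst.comp_hasDerivAt t (hα t (hsub ht)) using 1
    simp [hamField, dampField]
    ring
  have h2 : ∀ t ∈ Icc 0 T, HasDerivAt (fun t => (α t).2)
      (χ (α t) * ((α t).1 * (1 - (α t).2 ^ 2))) t := by
    intro t ht
    convert! hasFDerivAt_snd.comp_hasDerivAt t (hα t (hsub ht)) using 1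
    simp [hamField, dampField]
  have c1 : ContinuousOn (fun t => (α t).1) (Icc 0 T) :=
    fun t ht => (h1 t ht).continuousAt.continuousWithinAt
  have c2 : ContinuousOn (fun t => (α t).2) (Icc 0 T) :=
    fun t ht => (h2 t ht).continuousAt.continuousWithinAt
  have hmem := mem_Aadm_of_hasDerivAt (fun t _ => ⟨χ.nonneg, χ.le_one⟩)
    (fun t ht => div_nonneg (mul_nonneg zero_le_two (hφ.1 _ _).1) (by linarith [ht.1]))
    c1 c2 (fun t ht => h1 t (Ico_subset_Icc_self ht)) (fun t ht => h2 t (Ico_subset_Icc_self ht))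
    (by simpa [hα0] using hi)
  have hχ : ∀ t ∈ Icc 0 T, χ (α t) = 1 := fun t ht =>
    χ.one_of_mem_closedBall (mem_closedBall_zero_iff.2 (norm_le_of_mem_Aadm ha hb (hmem t ht)))
  refine ⟨fun t => (α t).1, fun t => (α t).2, by simp [hα0], by simp [hα0], c1, c2,
    fun t ht => ⟨?_, ?_⟩⟩
  · simpa only [hχ t ht, one_mul] using h1 t ht
  · simpa only [hχ t ht, one_mul] using h2 t ht

/-- A `C¹` vector field is Lipschitz on the bounded set `𝒜`. -/
lemma exists_lipschitzOnWith_Aadm {a b : ℝ} (ha : 0 < a) (hb : 0 < b) {V : ℝ × ℝ → ℝ × ℝ}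
    (hV : ContDiff ℝ 1 V) : ∃ K : ℝ≥0, LipschitzOnWith K V (Aadm a b) := by
  obtain ⟨K, hK⟩ := hV.locallyLipschitz.locallyLipschitzOn.exists_lipschitzOnWith_of_compact
    (isCompact_closedBall (0 : ℝ × ℝ) (a + 1))
  exact ⟨K, hK.mono fun p hp => mem_closedBall_zero_iff.2 (norm_le_of_mem_Aadm ha hb hp)⟩

lemma IsShiftSolOn.eq_of_mem_Icc {a b η ρ fi gi T : ℝ} {φ : ℝ → ℝ → ℝ} {f g F G : ℝ → ℝ}
    (ha : 0 < a) (hb : 0 < b) (hη : 0 < η) (hφ : IsCutoff a b η φ) (hρ : 0 < ρ)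
    (hi : (fi, gi) ∈ Aadm a b) (h : IsShiftSolOn a b φ ρ fi gi f g (Icc 0 T))
    (h' : IsShiftSolOn a b φ ρ fi gi F G (Icc 0 T)) :
    ∀ r ∈ Icc 0 T, (f r, g r) = (F r, G r) := by
  obtain ⟨K₁, hK₁⟩ := exists_lipschitzOnWith_Aadm ha hb (contDiff_hamField a b)
  obtain ⟨K₂, hK₂⟩ := exists_lipschitzOnWith_Aadm ha hb (hφ.contDiff_dampField hη)
  have hmem := h.mem_Aadm (fun x y => (hφ.1 x y).1) hρ hi
  have hmem' := h'.mem_Aadm (fun x y => (hφ.1 x y).1) hρ hi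
  intro r hr
  have key := dist_le_of_trajectories_ODE_of_mem (δ := 0)
    (v := fun t p => hamField a b p - (2 / (ρ + t)) • dampField φ p) (s := fun _ => Aadm a b)
    (K := K₁ + (2 / ρ).toNNReal * K₂)
    (fun t ht => lipschitzOnWith_sub_smul hK₁ hK₂ (by
      have ht0 := ht.1
      rw [abs_of_nonneg (by positivity), Real.coe_toNNReal _ (by positivity)]
      gcongr
      linarith))
    (h.2.2.1.prodMk h.2.2.2.1)
    (fun t ht => (h.hasDerivAt_prodMk (Ico_subset_Icc_self ht)).hasDerivWithinAt)
    (fun t ht => hmem t (Ico_subset_Icc_self ht)) (h'.2.2.1.prodMk h'.2.2.2.1)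
    (fun t ht => (h'.hasDerivAt_prodMk (Ico_subset_Icc_self ht)).hasDerivWithinAt)
    (fun t ht => hmem' t (Ico_subset_Icc_self ht))
    (by rw [h.1, h.2.1, h'.1, h'.2.1, dist_self]) r hr
  rw [zero_mul] at key
  exact dist_le_zero.1 key

lemma norm_dampField_le {φ : ℝ → ℝ → ℝ} {p : ℝ × ℝ} (hφ : φ p.1 p.2 ∈ Icc (0 : ℝ) 1) :
    ‖dampField φ p‖ ≤ ‖p‖ := by
  have h : |φ p.1 p.2 * p.1| ≤ |p.1| := by
    rw [abs_mul, abs_of_nonneg hφ.1]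
    exact mul_le_of_le_one_left (abs_nonneg _) hφ.2
  simpa [dampField, Prod.norm_def] using Or.inl h

/-- The Grönwall estimate between a solution of the shifted regularized system and a solution of
the autonomous system. -/
lemma IsShiftSolOn.dist_le_gronwallBound {a b ρ fi gi ft gt T : ℝ} {φ : ℝ → ℝ → ℝ}
    {f g F G : ℝ → ℝ} {K : ℝ≥0} (ha : 0 < a) (hb : 0 < b) (hφ : ∀ x y, φ x y ∈ Icc (0 : ℝ) 1)
    (hρ : 0 < ρ) (hK : LipschitzOnWith K (hamField a b) (Aadm a b)) (hi : (fi, gi) ∈ Aadm a b)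
    (ht : (ft, gt) ∈ Aadm a b) (h : IsShiftSolOn a b φ ρ fi gi F G (Icc 0 T))
    (h' : IsAutSolOn a b ft gt f g (Icc 0 T)) {r : ℝ} (hr : r ∈ Icc 0 T) :
    dist (F r, G r) (f r, g r) ≤
      gronwallBound (dist (fi, gi) (ft, gt)) K (2 / ρ * (a + 1)) T := by
  have hmem := h.mem_Aadm (fun x y => (hφ x y).1) hρ hi
  have hmem' := (h'.isShiftSolOn (ρ := ρ)).mem_Aadm (fun _ _ => le_rfl) hρ ht
  have key := dist_le_of_approx_trajectories_ODE_of_mem (v := fun _ => hamField a b)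
    (s := fun _ => Aadm a b) (εf := 2 / ρ * (a + 1)) (εg := 0) (δ := dist (fi, gi) (ft, gt))
    (g' := fun t => hamField a b (f t, g t)) (fun _ _ => hK) (h.2.2.1.prodMk h.2.2.2.1)
    (fun t ht => (h.hasDerivAt_prodMk (Ico_subset_Icc_self ht)).hasDerivWithinAt)
    (fun t ht => by
      have ht0 := ht.1
      rw [dist_eq_norm, sub_sub_cancel_left, norm_neg, norm_smul, Real.norm_eq_abs,
        abs_of_nonneg (by positivity)]
      gcongr
      · linarith
      · exact (norm_dampField_le (hφ _ _)).trans
          (norm_le_of_mem_Aadm ha hb (hmem t (Ico_subset_Icc_self ht))))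
    (fun t ht => hmem t (Ico_subset_Icc_self ht)) (h'.2.2.1.prodMk h'.2.2.2.1)
    (fun t ht => ((h'.2.2.2.2 t (Ico_subset_Icc_self ht)).1.prodMk
      (h'.2.2.2.2 t (Ico_subset_Icc_self ht)).2).hasDerivWithinAt)
    (fun t _ => (dist_self _).le) (fun t ht => hmem' t (Ico_subset_Icc_self ht))
    (by rw [h.1, h.2.1, h'.1, h'.2.1]) r hr
  rw [add_zero, sub_zero] at key
  exact key.trans (gronwallBound_mono dist_nonneg (by positivity) K.2 hr.2)

lemma tendsto_gronwallBound_zero {ι : Type*} {l : Filter ι} {δ ε : ι → ℝ}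
    (hδ : Tendsto δ l (𝓝 0)) (hε : Tendsto ε l (𝓝 0)) (K T : ℝ) :
    Tendsto (fun n => gronwallBound (δ n) K (ε n) T) l (𝓝 0) := by
  by_cases hK : K = 0
  · simpa [hK, gronwallBound_K0] using hδ.add (hε.mul_const T)
  · simpa [gronwallBound_of_K_ne_0 hK] using
      (hδ.mul_const (exp (K * T))).add ((hε.div_const K).mul_const (exp (K * T) - 1))

/-- Lemma 2.4: perturbed solutions of the shifted regularized system
are global and converge uniformly on bounded intervals to the solution of the
autonomous system. -/
theorem perturbation_convergence (a b η : ℝ) (hb : 0 < b) (hab : 2 * b < a)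
    (hη : η ∈ Ioo 0 (Real.sqrt (a - b) - Real.sqrt (a / 2)))
    (φ : ℝ → ℝ → ℝ) (hφ : IsCutoff a b η φ)
    (ft gt : ℝ) (hA : (ft, gt) ∈ Aadm a b)
    (f g : ℝ → ℝ) (hfg : IsAutSolOn a b ft gt f g (Ici 0))
    (ftn gtn : ℕ → ℝ) (hAn : ∀ n, (ftn n, gtn n) ∈ Aadm a b)
    (ρ : ℕ → ℝ) (hρpos : ∀ n, 0 < ρ n) (hρ : Tendsto ρ atTop atTop)
    (hconv : Tendsto (fun n => (ftn n, gtn n)) atTop (nhds (ft, gt)))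
    (fn gn : ℕ → ℝ → ℝ) (Rn : ℕ → EReal)
    (hsol : ∀ n, IsShiftSolOn a b φ (ρ n) (ftn n) (gtn n) (fn n) (gn n) (edom (Rn n)))
    (hmax : ∀ n, ∀ R' : EReal, Rn n < R' →
      ¬ ∃ F G : ℝ → ℝ, IsShiftSolOn a b φ (ρ n) (ftn n) (gtn n) F G (edom R') ∧
          EqOn F (fn n) (edom (Rn n)) ∧ EqOn G (gn n) (edom (Rn n))) :
    (∀ n, Rn n = ⊤) ∧
    ∀ T : ℝ, TendstoUniformlyOn (fun n r => (fn n r, gn n r))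
      (fun r => (f r, g r)) atTop (Icc 0 T) := by
  have ha : 0 < a := by linarith
  have hR : ∀ n, Rn n = ⊤ := by
    intro n
    by_contra hne
    obtain ⟨T, hT, -⟩ := EReal.lt_iff_exists_real_btwn.1 (lt_top_iff_ne_top.2 hne)
    obtain ⟨F, G, hFG⟩ := exists_isShiftSolOn ha hb hη.1 hφ (hρpos n) (hAn n)
      (lt_max_of_lt_right one_pos : 0 < max T 1)
    have hlt : Rn n < (max T 1 : ℝ) := hT.trans_le (EReal.coe_le_coe_iff.2 (le_max_left _ _))
    have heq : ∀ r ∈ edom (Rn n), (F r, G r) = (fn n r, gn n r) := fun r hr =>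
      (hFG.mono (Icc_subset_Icc_right (EReal.coe_lt_coe_iff.1 (hr.2.trans hlt)).le)).eq_of_mem_Icc
        ha hb hη.1 hφ (hρpos n) (hAn n) ((hsol n).mono (Icc_subset_edom hr)) r ⟨hr.1, le_rfl⟩
    exact hmax n _ hlt ⟨F, G,
      hFG.mono fun r hr => ⟨hr.1, (EReal.coe_lt_coe_iff.1 hr.2).le⟩,
      fun r hr => congrArg Prod.fst (heq r hr), fun r hr => congrArg Prod.snd (heq r hr)⟩
  refine ⟨hR, fun T => ?_⟩
  obtain ⟨K, hK⟩ := exists_lipschitzOnWith_Aadm ha hb (contDiff_hamField a b)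
  have hlim := tendsto_gronwallBound_zero (tendsto_iff_dist_tendsto_zero.1 hconv)
    (by simpa using (hρ.const_div_atTop 2).mul_const (a + 1)) K T
  rw [Metric.tendstoUniformlyOn_iff]
  intro ε hε
  filter_upwards [hlim.eventually (gt_mem_nhds hε)] with n hn r hr
  rw [dist_comm]
  refine lt_of_le_of_lt (IsShiftSolOn.dist_le_gronwallBound ha hb hφ.1 (hρpos n) hK (hAn n) hA
    ((hsol n).mono ?_) ?_ hr) hn
  · rw [hR n, edom_top]
    exact Icc_subset_Ici_self
  · exact ⟨hfg.1, hfg.2.1, hfg.2.2.1.mono Icc_subset_Ici_self,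
      hfg.2.2.2.1.mono Icc_subset_Ici_self, fun t ht => hfg.2.2.2.2 t ht.1⟩
end
end

section
/- Let a, b > 0 with a − 2b > 0, η ∈ (0, √(a−b) − √(a/2)), φ_η an admissible cutoff, and x ∈ (0,1). Let (f_{x,η}, g_{x,η}) be a nontrivial solution of the regularized system with f_{x,η}(0) = 0, g_{x,η}(0) = x. Then for any r₀ ∈ [0, +∞), the function g_{x,η} changes sign at r₀ if and only if g_{x,η}(r₀) = 0. -/
open Real Set Filter Topology

noncomputable section

/-- A differentiable function that vanishes at an interior point of `[0, ∞)` with nonzero derivative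
changes sign there. -/
theorem changesSignAt_of_hasDerivAt {g : ℝ → ℝ} {c r₀ : ℝ} (hr : 0 < r₀) (h0 : g r₀ = 0)
    (hc : c ≠ 0) (hg : HasDerivAt g c r₀) : ChangesSignAt g (Ici 0) r₀ := by
  have hslope : ∀ᶠ r in 𝓝[≠] r₀, 0 < c * slope g r₀ r :=
    ((hasDerivAt_iff_tendsto_slope.mp hg).const_mul c).eventually
      (lt_mem_nhds (mul_self_pos.mpr hc))
  obtain ⟨δ, hδ, hball⟩ := Metric.mem_nhdsWithin_iff.mp hslope
  have hneg : ∀ r, 0 < r → r < δ → g (r₀ - r) * g (r₀ + r) < 0 := by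
    intro r hr0 hrδ
    have h1 : 0 < c * slope g r₀ (r₀ - r) := by
      refine hball ⟨?_, ?_⟩
      · simpa [Real.dist_eq, abs_of_pos hr0] using hrδ
      · simp [hr0.ne']
    have h2 : 0 < c * slope g r₀ (r₀ + r) := by
      refine hball ⟨?_, ?_⟩
      · simpa [Real.dist_eq, abs_of_pos hr0] using hrδ
      · simp [hr0.ne']
    have hcr : 0 < r ^ 2 / c ^ 2 := by positivity
    have h3 := mul_pos (mul_pos h1 h2) hcr
    have h4 : c * slope g r₀ (r₀ - r) * (c * slope g r₀ (r₀ + r)) * (r ^ 2 / c ^ 2)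
        = -(g (r₀ - r) * g (r₀ + r)) := by
      simp only [slope_def_field, h0, sub_zero, add_sub_cancel_left]
      rw [show r₀ - r - r₀ = -r by ring]
      field_simp
    linarith
  have hε : 0 < min (δ / 2) r₀ := lt_min (by linarith) hr
  have hεδ : min (δ / 2) r₀ < δ := (min_le_left _ _).trans_lt (by linarith)
  refine ⟨h0, min (δ / 2) r₀, hε, ?_, hneg _ hε hεδ, ?_⟩
  · intro r hrm
    have := min_le_right (δ / 2) r₀
    exact mem_Ici.mpr (by linarith [hrm.1])
  · intro r hrm
    exact (hneg r hrm.1 (hrm.2.trans hεδ)).le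

/-- A nonnegative function with `N' ≥ -K N` that vanishes at the right endpoint of an interval
vanishes at the left endpoint. -/
theorem eq_zero_left_of_neg_mul_le_deriv {N N' : ℝ → ℝ} {K s t : ℝ} (hst : s ≤ t)
    (hN : ∀ r ∈ Icc s t, HasDerivAt N (N' r) r) (hK : ∀ r ∈ Icc s t, -(K * N r) ≤ N' r)
    (hs : 0 ≤ N s) (ht : N t = 0) : N s = 0 := by
  have hd : ∀ r ∈ Icc s t, HasDerivAt (fun r => N r * Real.exp (K * r))
      (N' r * Real.exp (K * r) + N r * (Real.exp (K * r) * K)) r := by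
    intro r hr
    have h1 : HasDerivAt (fun r : ℝ => K * r) K r := by
      simpa using (hasDerivAt_id r).const_mul K
    exact (hN r hr).mul h1.exp
  have hmono : MonotoneOn (fun r => N r * Real.exp (K * r)) (Icc s t) := by
    refine monotoneOn_of_deriv_nonneg (convex_Icc s t)
      (fun r hr => (hd r hr).continuousAt.continuousWithinAt)
      (fun r hr => (hd r (interior_subset hr)).differentiableAt.differentiableWithinAt) ?_
    intro r hr
    have hr' := interior_subset hr
    rw [(hd r hr').deriv]
    have := mul_nonneg (neg_le_iff_add_nonneg.mp (hK r hr')) (Real.exp_pos (K * r)).le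
    linarith
  have h := hmono (left_mem_Icc.mpr hst) (right_mem_Icc.mpr hst) hst
  simp only [ht, zero_mul] at h
  exact le_antisymm (nonpos_of_mul_nonpos_left h (Real.exp_pos _)) hs

/-- A solution of the regularized system that reaches the origin at some positive time has
`g = 0` at all earlier times, hence initial value `0`. -/
theorem IsRegSolOn.initial_eq_zero {a b x : ℝ} {φ : ℝ → ℝ → ℝ} {f g : ℝ → ℝ}
    (hφ : ∀ u v, φ u v ∈ Icc (0 : ℝ) 1) (hsol : IsRegSolOn a b φ x f g (Ici 0))
    {r₀ : ℝ} (hr₀ : 0 < r₀) (hf₀ : f r₀ = 0) (hg₀ : g r₀ = 0) : x = 0 := by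
  obtain ⟨-, hgx, hfc, hgc, hode⟩ := hsol
  have hsub : Icc 0 r₀ ⊆ Ici (0 : ℝ) := fun r hr => hr.1
  have hcont : ContinuousOn (fun r => f r ^ 2 - a * g r ^ 2 + b + 1 - g r ^ 2) (Icc 0 r₀) := by
    have hf := hfc.mono hsub
    have hg := hgc.mono hsub
    fun_prop
  obtain ⟨C, hC⟩ := isCompact_Icc.exists_bound_of_continuousOn hcont
  have hzero : ∀ s ∈ Ioc 0 r₀, g s = 0 := by
    rintro s ⟨hs, hsr⟩
    have hN : f s ^ 2 + g s ^ 2 = 0 := by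
      refine eq_zero_left_of_neg_mul_le_deriv (N := fun r => f r ^ 2 + g r ^ 2)
        (N' := fun r =>
          2 * f r * (g r * (f r ^ 2 - a * g r ^ 2 + b) - 2 * φ (f r) (g r) / r * f r)
            + 2 * g r * (f r * (1 - g r ^ 2)))
        (K := C + 4 / s) hsr (fun r hr => ?_) (fun r hr => ?_) (by positivity) (by simp [hf₀, hg₀])
      · have hr0 : 0 < r := hs.trans_le hr.1
        obtain ⟨h1, h2⟩ := hode r hr0.le hr0
        refine ((h1.pow 2).add (h2.pow 2)).congr_deriv ?_
        norm_num
      · have hr0 : 0 < r := hs.trans_le hr.1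
        have hbound := hC r ⟨hr0.le, hr.2⟩
        rw [Real.norm_eq_abs] at hbound
        obtain ⟨hφ0, hφ1⟩ := hφ (f r) (g r)
        have hdamp : φ (f r) (g r) / r ≤ 1 / s := by gcongr; exact hr.1
        have hs0 : 0 < 1 / s := by positivity
        have h2 : |2 * (f r * g r)| ≤ f r ^ 2 + g r ^ 2 := by
          rw [abs_le]
          constructor <;> nlinarith [sq_nonneg (f r + g r), sq_nonneg (f r - g r)]
        have h3 : |2 * (f r * g r) * (f r ^ 2 - a * g r ^ 2 + b + 1 - g r ^ 2)|
            ≤ (f r ^ 2 + g r ^ 2) * C := by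
          rw [abs_mul]
          gcongr
        have h4 := (abs_le.mp h3).1
        have h5 := mul_le_mul_of_nonneg_right hdamp (sq_nonneg (f r))
        have h6 := mul_nonneg hs0.le (sq_nonneg (g r))
        have e1 : 2 * φ (f r) (g r) / r = 2 * (φ (f r) (g r) / r) := by ring
        have e2 : 4 / s = 4 * (1 / s) := by ring
        simp only [e1, e2]
        linarith
    nlinarith [sq_nonneg (f s), sq_nonneg (g s)]
  have hlim : Tendsto g (𝓝[>] 0) (𝓝 x) := by
    have := hgc 0 self_mem_Ici
    rw [ContinuousWithinAt, hgx] at this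
    exact this.mono_left (nhdsWithin_mono _ Ioi_subset_Ici_self)
  have hev : g =ᶠ[𝓝[>] 0] fun _ => 0 := by
    filter_upwards [Ioc_mem_nhdsGT hr₀] with s hs using hzero s hs
  exact tendsto_nhds_unique hlim (tendsto_const_nhds.congr' hev.symm)

/-- Remark 2.6: for a nontrivial solution of the regularized system,
`g_{x,η}` changes sign at `r₀ ∈ [0,∞)` if and only if it vanishes at `r₀`. -/
theorem changes_sign_iff_vanishes (a b η : ℝ) (hb : 0 < b) (hab : 2 * b < a)
    (hη : η ∈ Ioo 0 (Real.sqrt (a - b) - Real.sqrt (a / 2)))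
    (φ : ℝ → ℝ → ℝ) (hφ : IsCutoff a b η φ)
    (x : ℝ) (hx : x ∈ Ioo (0 : ℝ) 1)
    (f g : ℝ → ℝ) (hsol : IsRegSolOn a b φ x f g (Ici 0)) :
    ∀ r₀ ≥ 0, (ChangesSignAt g (Ici 0) r₀ ↔ g r₀ = 0) := by
  intro r₀ hr₀
  refine ⟨fun h => h.1, fun hg₀ => ?_⟩
  have hpos : 0 < r₀ := by
    refine lt_of_le_of_ne hr₀ ?_
    rintro rfl
    exact hx.1.ne' (hsol.2.1.symm.trans hg₀)
  have hf₀ : f r₀ ≠ 0 := fun h => hx.1.ne' (hsol.initial_eq_zero hφ.1 hpos h hg₀)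
  have hderiv := (hsol.2.2.2.2 r₀ hr₀ hpos).2
  exact changesSignAt_of_hasDerivAt hpos hg₀ (by simpa [hg₀] using hf₀) hderiv
end
end
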